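/- (Lemma 2.4) Let R be a commutative ring and X a topological space. Let (ℏ_k)_{k ≥ 0} be a pre-chain map on X with coefficients in R such that ℏ_0(σ) = 0 for every singular 0-simplex σ of X. Then there exists a family of maps D_k (k ≥ 0), assigning to each singular k-simplex σ of X a finite chain D_k(σ) ∈ S_{k+1}(Δ^k;R), such that D_0 = 0 and for every k ≥ 1 and every singular k-simplex σ of X, ∂(D_k(σ)) = ℏ_k(σ) − ∑_{p=0}^{k} (−1)^p (ι_{k;p})_#(D_{k−1}(σ ∘ ι_{k;p})) in S_k(Δ^k;R). -/

import Mathlib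

open Set

attribute [local instance] Classical.propDecidable

noncomputable section

/-- The standard `k`-simplex, as a topological space. -/
abbrev Δ (k : ℕ) : Type := ↥(stdSimplex ℝ (Fin (k+1)))

/-- A singular `k`-simplex in `Y`: a continuous map from the standard `k`-simplex. -/
abbrev SSimplex (Y : Type*) [TopologicalSpace Y] (k : ℕ) : Type _ := C(Δ k, Y)

/-- `S_p(Y;R)`: finite singular `p`-chains, i.e. finitely supported functions from
the singular `p`-simplices of `Y` to `R`. -/
abbrev FChain (Y : Type*) [TopologicalSpace Y] (R : Type*) [CommRing R] (p : ℕ) : Type _ :=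
  SSimplex Y p →₀ R

/-- The affine map between standard simplices extending `e i ↦ e (m i)` on vertices. -/
def affMap {a b : ℕ} (m : Fin a → Fin b) :
    C(↥(stdSimplex ℝ (Fin a)), ↥(stdSimplex ℝ (Fin b))) where
  toFun t :=
    ⟨fun j => ∑ i, if m i = j then t.1 i else 0, by
      constructor
      · intro j
        refine Finset.sum_nonneg fun i _ => ?_
        by_cases h : m i = j
        · simpa [h] using t.2.1 i
        · simp [h]
      · rw [Finset.sum_comm]
        have h1 : ∀ i : Fin a, (∑ j, if m i = j then t.1 i else 0) = t.1 i := by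
          intro i
          simp [Finset.sum_ite_eq]
        calc (∑ i, ∑ j, if m i = j then t.1 i else 0) = ∑ i, t.1 i :=
              Finset.sum_congr rfl fun i _ => h1 i
          _ = 1 := t.2.2⟩
  continuous_toFun := by
    apply Continuous.subtype_mk
    apply continuous_pi
    intro j
    apply continuous_finset_sum
    intro i _
    by_cases h : m i = j
    · simp only [if_pos h]
      exact (continuous_apply i).comp continuous_subtype_val
    · simp only [h, if_false]
      exact continuous_const

/-- The `p`-th face inclusion `ι_{k+1;p} : Δ^k → Δ^{k+1}`, sending the vertices
`e_0, …, e_k` in order to the vertices `e_0, …, e_{p-1}, e_{p+1}, …, e_{k+1}`. -/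
def face (k : ℕ) (p : Fin (k+2)) : C(Δ k, Δ (k+1)) := affMap (Fin.succAbove p)

/-- The pushforward `g_# : S_p(Y;R) → S_p(Y';R)`, the linear extension of `σ ↦ g ∘ σ`. -/
def fpush {Y Y' : Type*} [TopologicalSpace Y] [TopologicalSpace Y'] {R : Type*} [CommRing R]
    {p : ℕ} (g : C(Y, Y')) (c : FChain Y R p) : FChain Y' R p :=
  Finsupp.mapDomain (fun σ : SSimplex Y p => g.comp σ) c

/-- The boundary operator `∂ : S_{k+1}(Y;R) → S_k(Y;R)`, the linear extension of
`σ ↦ ∑_p (-1)^p (σ ∘ ι_{k+1;p})`. -/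
def fboundary {Y : Type*} [TopologicalSpace Y] {R : Type*} [CommRing R] (k : ℕ)
    (c : FChain Y R (k+1)) : FChain Y R k :=
  c.sum fun σ a =>
    ∑ p : Fin (k+2), Finsupp.single (σ.comp (face k p)) ((-1 : R)^(p : ℕ) * a)

/-- A pre-chain map on `X` with coefficients in `R`: a family of maps
`ℏ_k : Hom(Δ^k,X) → S_k(Δ^k;R)` satisfying the compatibility
`∂(ℏ_{k+1}(σ)) = ∑_p (-1)^p (ι_{k+1;p})_#(ℏ_k(σ ∘ ι_{k+1;p}))`. -/
def IsPreChainMap {X : Type*} [TopologicalSpace X] {R : Type*} [CommRing R]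
    (hb : ∀ k : ℕ, SSimplex X k → FChain (Δ k) R k) : Prop :=
  ∀ (k : ℕ) (σ : SSimplex X (k+1)),
    fboundary k (hb (k+1) σ) =
      ∑ p : Fin (k+2), (-1 : R)^(p : ℕ) • fpush (face k p) (hb k (σ.comp (face k p)))

/-! ### Linearity of the boundary operator and of pushforwards -/

section Linear

variable {X Y Z R : Type*} [TopologicalSpace X] [TopologicalSpace Y] [TopologicalSpace Z]
  [CommRing R]

/-- The boundary operator, bundled as a linear map. -/
def fboundaryₗ (Y R : Type*) [TopologicalSpace Y] [CommRing R] (k : ℕ) :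
    FChain Y R (k + 1) →ₗ[R] FChain Y R k :=
  Finsupp.lsum R fun σ => ∑ p : Fin (k + 2),
    (-1 : R) ^ (p : ℕ) • Finsupp.lsingle (σ.comp (face k p))

theorem fboundaryₗ_apply (k : ℕ) (c : FChain Y R (k + 1)) :
    fboundaryₗ Y R k c = fboundary k c := by
  rw [fboundaryₗ, Finsupp.lsum_apply, fboundary]
  refine Finsupp.sum_congr fun σ _ => ?_
  simp only [LinearMap.sum_apply, LinearMap.smul_apply, Finsupp.lsingle_apply,
    Finsupp.smul_single, smul_eq_mul]

theorem fboundaryₗ_single (k : ℕ) (σ : SSimplex Y (k + 1)) (a : R) :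
    fboundaryₗ Y R k (Finsupp.single σ a) =
      ∑ p : Fin (k + 2), (-1 : R) ^ (p : ℕ) • Finsupp.single (σ.comp (face k p)) a := by
  simp [fboundaryₗ]

/-- The pushforward of chains, bundled as a linear map. -/
def fpushₗ (R : Type*) [CommRing R] (k : ℕ) (g : C(X, Y)) : FChain X R k →ₗ[R] FChain Y R k :=
  Finsupp.lmapDomain R R fun σ : SSimplex X k => g.comp σ

theorem fpushₗ_single (k : ℕ) (g : C(X, Y)) (σ : SSimplex X k) (a : R) :
    fpushₗ R k g (Finsupp.single σ a) = Finsupp.single (g.comp σ) a := by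
  simp [fpushₗ]

theorem fboundaryₗ_fpushₗ (k : ℕ) (g : C(X, Y)) (c : FChain X R (k + 1)) :
    fboundaryₗ Y R k (fpushₗ R (k + 1) g c) = fpushₗ R k g (fboundaryₗ X R k c) := by
  induction c using Finsupp.induction_linear with
  | zero => simp
  | add c d hc hd => simp only [map_add, hc, hd]
  | single σ a =>
    simp only [fpushₗ_single, fboundaryₗ_single, map_sum, map_smul, ContinuousMap.comp_assoc]

theorem fpushₗ_fpushₗ (k : ℕ) (g : C(Y, Z)) (f : C(X, Y)) (c : FChain X R k) :
    fpushₗ R k g (fpushₗ R k f c) = fpushₗ R k (g.comp f) c := by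
  induction c using Finsupp.induction_linear with
  | zero => simp
  | add c d hc hd => simp only [map_add, hc, hd]
  | single σ a => simp only [fpushₗ_single, ContinuousMap.comp_assoc]

end Linear

/-! ### Face inclusions -/

theorem affMap_apply {a b : ℕ} (m : Fin a → Fin b) (t : stdSimplex ℝ (Fin a)) (j : Fin b) :
    (affMap m t).1 j = ∑ i, if m i = j then t.1 i else 0 :=
  rfl

theorem affMap_comp {a b c : ℕ} (m : Fin b → Fin c) (n : Fin a → Fin b) :
    (affMap m).comp (affMap n) = affMap (m ∘ n) := by
  ext t j
  change (affMap m (affMap n t)).1 j = (affMap (m ∘ n) t).1 j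
  simp only [affMap_apply, Function.comp_apply]
  simp_rw [← Finset.sum_filter]
  rw [Finset.sum_comm' (t' := Finset.univ.filter fun i => m (n i) = j) (s' := fun i => {n i})]
  · simp
  · intro x y
    simp only [Finset.mem_filter, Finset.mem_univ, true_and, Finset.mem_singleton]
    grind

theorem face_comp_face (k : ℕ) (i : Fin (k + 3)) (j : Fin (k + 2)) :
    (face (k + 1) (i.succAbove j)).comp (face k (j.predAbove i)) =
      (face (k + 1) i).comp (face k j) := by
  simp only [face, affMap_comp]
  congr 1
  ext r : 1
  exact Fin.succAbove_succAbove_succAbove_predAbove i j r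

/-- The alternating sum over all pairs of consecutive face inclusions vanishes. -/
theorem sum_face_comp_face_eq_zero {R M : Type*} [CommRing R] [AddCommGroup M] [Module R M]
    (k : ℕ) (f : C(Δ k, Δ (k + 2)) → M) :
    ∑ p : Fin (k + 3), ∑ q : Fin (k + 2),
      (-1 : R) ^ (p + q : ℕ) • f ((face (k + 1) p).comp (face k q)) = 0 := by
  rw [← Finset.sum_product']
  refine Finset.sum_involution (fun x _ => (x.1.succAbove x.2, x.2.predAbove x.1)) ?_ ?_ ?_ ?_
  · rintro ⟨p, q⟩ -
    simp only [face_comp_face, Fin.neg_one_pow_succAbove_add_predAbove, neg_smul,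
      add_neg_cancel]
  · rintro ⟨p, q⟩ - - h
    exact Fin.succAbove_ne p q (congrArg Prod.fst h)
  · simp
  · rintro ⟨p, q⟩ -
    simp only [Fin.succAbove_succAbove_predAbove, Fin.predAbove_predAbove_succAbove]

theorem face_zero_apply_zero (k : ℕ) (t : Δ k) : (face k 0 t).1 0 = 0 := by
  simp [face, affMap_apply]

theorem face_zero_apply_succ (k : ℕ) (t : Δ k) (j : Fin (k + 1)) :
    (face k 0 t).1 j.succ = t.1 j := by
  simp [face, affMap_apply]

theorem face_succ_apply_zero (k : ℕ) (p : Fin (k + 2)) (t : Δ (k + 1)) :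
    (face (k + 1) p.succ t).1 0 = t.1 0 := by
  simp [face, affMap_apply, Fin.sum_univ_succ]

theorem face_succ_apply_succ (k : ℕ) (p : Fin (k + 2)) (t : Δ (k + 1)) (j : Fin (k + 2)) :
    (face (k + 1) p.succ t).1 j.succ =
      ∑ i : Fin (k + 1), if p.succAbove i = j then t.1 i.succ else 0 := by
  simp [face, affMap_apply, Fin.sum_univ_succ (n := k + 1), (Fin.succ_ne_zero _).symm]

/-! ### The cone construction -/

theorem one_sub_apply_zero (k : ℕ) (t : Δ (k + 1)) :
    1 - t.1 0 = ∑ i : Fin (k + 1), t.1 i.succ := by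
  have h := t.2.2
  rw [Fin.sum_univ_succ] at h
  linarith

/-- The projection of `Δ (k + 1)`, away from its vertex `e 0`, to the opposite face.
Its value at `e 0` is irrelevant. -/
def projOpp (k : ℕ) (t : Δ (k + 1)) : Δ k :=
  if h : t.1 0 = 1 then stdSimplex.vertex 0 else
    ⟨fun i => t.1 i.succ / (1 - t.1 0), fun i => div_nonneg (t.2.1 _) (by
      rw [one_sub_apply_zero]; exact Finset.sum_nonneg fun i _ => t.2.1 _), by
      rw [← Finset.sum_div, ← one_sub_apply_zero, div_self (sub_ne_zero.2 (Ne.symm h))]⟩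

theorem projOpp_apply (k : ℕ) {t : Δ (k + 1)} (h : t.1 0 ≠ 1) (i : Fin (k + 1)) :
    (projOpp k t).1 i = t.1 i.succ / (1 - t.1 0) := by
  simp [projOpp, h]

theorem continuous_coord (k : ℕ) (i : Fin (k + 1)) : Continuous fun t : Δ k => t.1 i :=
  (continuous_apply i).comp continuous_subtype_val

theorem continuousOn_projOpp (k : ℕ) : ContinuousOn (projOpp k) {t | t.1 0 ≠ 1} := by
  rw [Topology.IsInducing.subtypeVal.continuousOn_iff, continuousOn_pi]
  intro i
  refine ContinuousOn.congr (f := fun t : Δ (k + 1) => t.1 i.succ / (1 - t.1 0)) ?_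
    fun t ht => projOpp_apply k ht i
  exact (continuous_coord _ _).continuousOn.div
    (continuous_const.sub (continuous_coord _ _)).continuousOn
    fun t ht => sub_ne_zero.2 (Ne.symm ht)

theorem projOpp_face_zero (k : ℕ) (t : Δ k) : projOpp k (face k 0 t) = t := by
  ext i
  change (projOpp k (face k 0 t)).1 i = t.1 i
  rw [projOpp_apply _ (by simp [face_zero_apply_zero]), face_zero_apply_zero,
    face_zero_apply_succ]
  simp

theorem projOpp_face_succ (k : ℕ) (p : Fin (k + 2)) {t : Δ (k + 1)} (h : t.1 0 ≠ 1) :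
    projOpp (k + 1) (face (k + 1) p.succ t) = face k p (projOpp k t) := by
  ext j
  change (projOpp (k + 1) (face (k + 1) p.succ t)).1 j = (face k p (projOpp k t)).1 j
  rw [projOpp_apply _ (by rwa [face_succ_apply_zero]), face_succ_apply_zero,
    face_succ_apply_succ, face, affMap_apply, Finset.sum_div]
  refine Finset.sum_congr rfl fun i _ => ?_
  rw [projOpp_apply _ h]
  split_ifs <;> simp

/-- The join of the point `b` with the singular simplex `σ` in a standard simplex. -/
def coneSimplex {n : ℕ} (b : Δ n) (k : ℕ) (σ : SSimplex (Δ n) k) : SSimplex (Δ n) (k + 1) where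
  toFun t := ⟨t.1 0 • b.1 + (1 - t.1 0) • (σ (projOpp k t)).1,
    convex_stdSimplex ℝ _ b.2 (σ (projOpp k t)).2 (t.2.1 0)
      (by rw [one_sub_apply_zero]; exact Finset.sum_nonneg fun i _ => t.2.1 _) (by ring)⟩
  continuous_toFun := by
    refine Continuous.subtype_mk (continuous_pi fun j => ?_) _
    simp only [Pi.add_apply, Pi.smul_apply, smul_eq_mul]
    refine ((continuous_coord _ _).mul continuous_const).add ?_
    refine continuous_iff_continuousAt.2 fun t => ?_
    by_cases ht : t.1 0 = 1
    · have hlim : Filter.Tendsto (fun s : Δ (k + 1) => 1 - s.1 0) (nhds t) (nhds 0) := by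
        have := (continuous_const.sub (continuous_coord (k + 1) 0)).tendsto (x := t)
          (f := fun s : Δ (k + 1) => (1 : ℝ) - s.1 0)
        rwa [ht, sub_self] at this
      have := bdd_le_mul_tendsto_zero' (f := fun s : Δ (k + 1) => (σ (projOpp k s)).1 j) 1
        (Filter.Eventually.of_forall fun s => abs_le.2
          ⟨by linarith [(σ (projOpp k s)).2.1 j],
            (mem_Icc_of_mem_stdSimplex (σ (projOpp k s)).2 j).2⟩) hlim
      simpa [ContinuousAt, ht, mul_comm] using this
    · have hopen : IsOpen {t : Δ (k + 1) | t.1 0 ≠ 1} :=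
        isOpen_ne_fun (continuous_coord _ _) continuous_const
      have hproj : ContinuousAt (projOpp k) t :=
        (continuousOn_projOpp k).continuousAt (hopen.mem_nhds ht)
      exact ((continuous_const.sub (continuous_coord _ _)).continuousAt).mul
        (((continuous_coord n j).comp σ.continuous).continuousAt.comp hproj)

theorem coneSimplex_apply {n : ℕ} (b : Δ n) (k : ℕ) (σ : SSimplex (Δ n) k) (t : Δ (k + 1)) :
    (coneSimplex b k σ t).1 = t.1 0 • b.1 + (1 - t.1 0) • (σ (projOpp k t)).1 :=
  rfl

theorem coneSimplex_comp_face_zero {n : ℕ} (b : Δ n) (k : ℕ) (σ : SSimplex (Δ n) k) :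
    (coneSimplex b k σ).comp (face k 0) = σ := by
  refine ContinuousMap.ext fun t => Subtype.ext ?_
  rw [ContinuousMap.comp_apply, coneSimplex_apply, face_zero_apply_zero, projOpp_face_zero]
  simp

theorem coneSimplex_comp_face_succ {n : ℕ} (b : Δ n) (k : ℕ) (σ : SSimplex (Δ n) (k + 1))
    (p : Fin (k + 2)) :
    (coneSimplex b (k + 1) σ).comp (face (k + 1) p.succ) = coneSimplex b k (σ.comp (face k p)) := by
  refine ContinuousMap.ext fun t => Subtype.ext ?_
  rw [ContinuousMap.comp_apply, coneSimplex_apply, coneSimplex_apply, face_succ_apply_zero]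
  by_cases h : t.1 0 = 1
  · simp [h]
  · rw [projOpp_face_succ k p h, ContinuousMap.comp_apply]

/-- The cone operator on chains of a standard simplex. -/
def cone (R : Type*) [CommRing R] {n : ℕ} (b : Δ n) (k : ℕ) :
    FChain (Δ n) R k →ₗ[R] FChain (Δ n) R (k + 1) :=
  Finsupp.lmapDomain R R (coneSimplex b k)

theorem cone_single {R : Type*} [CommRing R] {n : ℕ} (b : Δ n) (k : ℕ) (σ : SSimplex (Δ n) k)
    (a : R) : cone R b k (Finsupp.single σ a) = Finsupp.single (coneSimplex b k σ) a := by
  simp [cone]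

theorem fboundaryₗ_cone {R : Type*} [CommRing R] {n : ℕ} (b : Δ n) (k : ℕ)
    (c : FChain (Δ n) R (k + 1)) :
    fboundaryₗ (Δ n) R (k + 1) (cone R b (k + 1) c) =
      c - cone R b k (fboundaryₗ (Δ n) R k c) := by
  induction c using Finsupp.induction_linear with
  | zero => simp
  | add c d hc hd => simp only [map_add, hc, hd]; abel
  | single σ a =>
    rw [cone_single, fboundaryₗ_single, fboundaryₗ_single, Fin.sum_univ_succ,
      coneSimplex_comp_face_zero]
    simp only [coneSimplex_comp_face_succ, map_sum, map_smul, cone_single, Fin.val_succ, pow_succ,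
      mul_neg_one, neg_smul, Finset.sum_neg_distrib, Fin.val_zero, pow_zero, one_smul,
      sub_eq_add_neg]

/-! ### Null-homotopies of pre-chain maps -/

section NullHomotopy

variable {X R : Type*} [TopologicalSpace X] [CommRing R]

/-- The alternating sum of the pushforwards along the face inclusions of chains attached to the
faces of `σ`. -/
def faceSum (k m : ℕ) (c : SSimplex X k → FChain (Δ k) R m) (σ : SSimplex X (k + 1)) :
    FChain (Δ (k + 1)) R m :=
  ∑ p : Fin (k + 2), (-1 : R) ^ (p : ℕ) • fpushₗ R m (face k p) (c (σ.comp (face k p)))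

theorem fboundaryₗ_faceSum (k m : ℕ) (c : SSimplex X k → FChain (Δ k) R (m + 1))
    (σ : SSimplex X (k + 1)) :
    fboundaryₗ _ R m (faceSum k (m + 1) c σ) = faceSum k m (fun τ => fboundaryₗ _ R m (c τ)) σ := by
  simp only [faceSum, map_sum, map_smul, fboundaryₗ_fpushₗ]

theorem faceSum_sub (k m : ℕ) (c d : SSimplex X k → FChain (Δ k) R m) (σ : SSimplex X (k + 1)) :
    faceSum k m (fun τ => c τ - d τ) σ = faceSum k m c σ - faceSum k m d σ := by
  simp only [faceSum, map_sub, smul_sub, Finset.sum_sub_distrib]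

theorem faceSum_faceSum (k m : ℕ) (c : SSimplex X k → FChain (Δ k) R m)
    (σ : SSimplex X (k + 2)) : faceSum (k + 1) m (faceSum k m c) σ = 0 := by
  simp only [faceSum, map_sum, map_smul, Finset.smul_sum, smul_smul, ← pow_add, fpushₗ_fpushₗ,
    ContinuousMap.comp_assoc]
  exact sum_face_comp_face_eq_zero k fun g => fpushₗ R m g (c (σ.comp g))

/-- The null-homotopy of a pre-chain map obtained by coning off, degree by degree. -/
def nullHomotopy (hb : ∀ k : ℕ, SSimplex X k → FChain (Δ k) R k) :
    ∀ k : ℕ, SSimplex X k → FChain (Δ k) R (k + 1)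
  | 0, _ => 0
  | k + 1, σ => cone R (stdSimplex.vertex 0) (k + 1)
      (hb (k + 1) σ - faceSum k (k + 1) (nullHomotopy hb k) σ)

theorem fboundaryₗ_nullHomotopy {hb : ∀ k : ℕ, SSimplex X k → FChain (Δ k) R k}
    (hpre : ∀ (k : ℕ) (σ : SSimplex X (k + 1)),
      fboundaryₗ _ R k (hb (k + 1) σ) = faceSum k k (hb k) σ)
    (h0 : ∀ σ : SSimplex X 0, hb 0 σ = 0) (k : ℕ) (σ : SSimplex X (k + 1)) :
    fboundaryₗ _ R (k + 1) (nullHomotopy hb (k + 1) σ) =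
      hb (k + 1) σ - faceSum k (k + 1) (nullHomotopy hb k) σ := by
  have key : fboundaryₗ _ R k (hb (k + 1) σ - faceSum k (k + 1) (nullHomotopy hb k) σ) = 0 := by
    rw [map_sub, hpre, fboundaryₗ_faceSum, ← faceSum_sub]
    cases k with
    | zero => simp [faceSum, h0, nullHomotopy]
    | succ k =>
      simp only [fboundaryₗ_nullHomotopy hpre h0 k, sub_sub_cancel]
      exact faceSum_faceSum k _ _ σ
  rw [nullHomotopy, fboundaryₗ_cone, key, map_zero, sub_zero]

end NullHomotopy

theorem preChainMap_nullHomotopy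
    {X : Type*} [TopologicalSpace X] {R : Type*} [CommRing R]
    (hb : ∀ k : ℕ, SSimplex X k → FChain (Δ k) R k)
    (hpre : IsPreChainMap hb)
    (h0 : ∀ σ : SSimplex X 0, hb 0 σ = 0) :
    ∃ D : ∀ k : ℕ, SSimplex X k → FChain (Δ k) R (k+1),
      (∀ σ : SSimplex X 0, D 0 σ = 0) ∧
      ∀ (k : ℕ) (σ : SSimplex X (k+1)),
        fboundary (k+1) (D (k+1) σ) =
          hb (k+1) σ -
            ∑ p : Fin (k+2), (-1 : R)^(p : ℕ) • fpush (face k p) (D k (σ.comp (face k p))) := by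
  refine ⟨nullHomotopy hb, fun σ => rfl, fun k σ => ?_⟩
  rw [← fboundaryₗ_apply]
  exact fboundaryₗ_nullHomotopy (fun k σ => (fboundaryₗ_apply k _).trans (hpre k σ)) h0 k σ

end
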